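/- arXiv:2412.14936 — 3 statements merged into one kernel-verified Lean document; each statement's English description precedes it below -/
import Mathlib

section
/- Let G be a finite simple graph with n vertices, average degree d, and degree deviation s with s > 0. If either s > dn/√2, or s ≤ dn/√2 and d ≤ n/2, then λ(G) − d ≥ s²/(n²√(2dn)). -/
/-- `l` is the largest eigenvalue (spectral radius) of the real matrix `A`. -/
def IsLargestEigenvalue {V : Type*} [Fintype V] (A : Matrix V V ℝ) (l : ℝ) : Prop :=
  (∃ v : V → ℝ, v ≠ 0 ∧ A.mulVec v = l • v) ∧
  ∀ μ : ℝ, (∃ v : V → ℝ, v ≠ 0 ∧ A.mulVec v = μ • v) → μ ≤ l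

theorem aux_rayleigh {V : Type*} [Fintype V] [DecidableEq V] (A : Matrix V V ℝ)
    (hA : A.IsHermitian) (lam : ℝ) (h : IsLargestEigenvalue A lam) (x : V → ℝ) :
    x ⬝ᵥ A.mulVec x ≤ lam * (x ⬝ᵥ x) := by
  have hB : (lam • (1 : Matrix V V ℝ) - A).IsHermitian := by
    have h1 : (lam • (1 : Matrix V V ℝ)).IsHermitian := by
      simp [Matrix.IsHermitian, Matrix.conjTranspose_smul]
    exact h1.sub hA
  have hP : (lam • (1 : Matrix V V ℝ) - A).PosSemidef := by
    rw [hB.posSemidef_iff_eigenvalues_nonneg]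
    intro i
    have hv := hB.mulVec_eigenvectorBasis i
    have hne : (hB.eigenvectorBasis i).ofLp ≠ 0 := by
      intro h0
      have := hB.eigenvectorBasis.orthonormal.ne_zero i
      apply this
      ext j
      simpa using congrFun h0 j
    have := h.2 (lam - hB.eigenvalues i) ⟨(hB.eigenvectorBasis i).ofLp, hne, by
      rw [Matrix.sub_mulVec, Matrix.smul_mulVec, Matrix.one_mulVec] at hv
      rw [sub_smul, ← hv]
      abel⟩
    simp only [Pi.zero_apply]
    linarith
  have := hP.dotProduct_mulVec_nonneg x
  rw [Matrix.sub_mulVec, Matrix.smul_mulVec, Matrix.one_mulVec, dotProduct_sub,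
    dotProduct_smul] at this
  simp only [star_trivial, smul_eq_mul] at this
  linarith

theorem aux_real (n d s a b y e K : ℝ) (hn : 0 < n) (hd : 0 < d) (hdn : d ≤ n) (hs : 0 < s)
    (ha : 0 ≤ a) (hb : 0 ≤ b) (hab : a + b = n) (he : 0 ≤ e)
    (h1 : y ≤ a * d + s / 2) (h2 : y ≤ b * d - s / 2)
    (hs1 : s ≤ 2 * b * d) (hs2 : s ≤ 2 * a * n)
    (hK : 0 < K) (hK2 : K ^ 2 = 2 * d * n)
    (hcase : d ^ 2 * n ^ 2 ≤ 2 * s ^ 2 ∨ d ≤ n / 2)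
    (hq : s ^ 2 / 4 ≤ a * b * e ^ 2 + ((a - b) * s / 2 + y * n) * e) :
    s ^ 2 / (n ^ 2 * K) ≤ e := by
  by_contra hlt
  push Not at hlt
  set e0 := s ^ 2 / (n ^ 2 * K) with he0
  have hM1 : (a - b) * s / 2 + y * n ≤ a * (n * d + s) := by
    subst hab; nlinarith [mul_le_mul_of_nonneg_right h1 hn.le]
  have hM2 : (a - b) * s / 2 + y * n ≤ b * (n * d - s) := by
    subst hab; nlinarith [mul_le_mul_of_nonneg_right h2 hn.le]
  set M := (a - b) * s / 2 + y * n with hM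
  have h4 : 4 * (a * b) ≤ n ^ 2 := by subst hab; nlinarith [sq_nonneg (a - b)]
  have hab0 : 0 ≤ a * b := mul_nonneg ha hb
  have hKe : e0 * (n ^ 2 * K) = s ^ 2 := by rw [he0]; field_simp
  have he00 : 0 ≤ e0 := by positivity
  have key : a * b * e0 + M ≤ n ^ 2 * K / 4 := by
    rcases le_total s (n * d) with hsn | hsn
    · have hM3 : M * (2 * d) ≤ n ^ 2 * d ^ 2 - s ^ 2 := by
        have p1 := mul_le_mul_of_nonneg_left hM1 (sub_nonneg.2 hsn)
        have p2 := mul_le_mul_of_nonneg_left hM2 (by positivity : 0 ≤ n * d + s)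
        have : n * (M * (2 * d)) ≤ n * (n ^ 2 * d ^ 2 - s ^ 2) := by
          have : n * (n ^ 2 * d ^ 2 - s ^ 2) = (a + b) * (n ^ 2 * d ^ 2 - s ^ 2) := by rw [hab]
          nlinarith
        exact le_of_mul_le_mul_left this hn
      have h5 : a * b * e0 * (4 * K) ≤ s ^ 2 := by
        nlinarith [mul_le_mul_of_nonneg_right h4 (mul_nonneg he00 hK.le)]
      -- multiply everything by 4 d K
      have hdK : d ≤ K := by
        rw [← pow_le_pow_iff_left₀ hd.le hK.le two_ne_zero, hK2]
        linarith [mul_le_mul_of_nonneg_left hdn hd.le, mul_pos hd hn, sq d]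
      have goal' : d * s ^ 2 + 2 * K * (n ^ 2 * d ^ 2 - s ^ 2) ≤ n ^ 2 * K ^ 2 * d := by
        rcases hcase with hc | hc
        · have hK3 : K ≤ 3 / 2 * n := by
            rw [← pow_le_pow_iff_left₀ hK.le (by positivity) two_ne_zero, hK2]
            linear_combination 2 * mul_le_mul_of_nonneg_right hdn hn.le + 1 / 4 * sq_nonneg n
          have e1 : (2 * K - d) * (d ^ 2 * n ^ 2) ≤ (2 * K - d) * (2 * s ^ 2) :=
            mul_le_mul_of_nonneg_left hc (by linarith)
          have e2 : 0 ≤ n ^ 2 * d ^ 2 * (4 * n - 2 * K - d) := by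
            have : 0 ≤ 4 * n - 2 * K - d := by linarith
            positivity
          rw [hK2]
          linear_combination (e1 + e2) / 2
        · have hK3 : 2 * d ≤ K := by
            rw [← pow_le_pow_iff_left₀ (by positivity) hK.le two_ne_zero, hK2]
            linear_combination 4 * mul_le_mul_of_nonneg_left hc hd.le
          have e1 : d * s ^ 2 ≤ K * s ^ 2 := mul_le_mul_of_nonneg_right hdK (sq_nonneg s)
          have e2 : 2 * d * (n ^ 2 * K * d) ≤ K * (n ^ 2 * K * d) :=
            mul_le_mul_of_nonneg_right hK3 (by positivity)
          have e3 : 0 ≤ K * s ^ 2 := by positivity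
          linear_combination e1 + e2 + e3
      have : (a * b * e0 + M) * (4 * d * K) ≤ (n ^ 2 * K / 4) * (4 * d * K) := by
        linear_combination mul_le_mul_of_nonneg_right h5 hd.le
          + 2 * mul_le_mul_of_nonneg_right hM3 hK.le + goal'
      exact le_of_mul_le_mul_right this (by positivity)
    · have hM0 : M ≤ 0 := by nlinarith
      have p1 : s * s ≤ (2 * b * d) * (2 * a * n) := mul_le_mul hs1 hs2 hs.le (by positivity)
      have p2 : (4 * (a * b)) * (4 * (a * b)) ≤ n ^ 2 * n ^ 2 :=
        mul_le_mul h4 h4 (by positivity) (by positivity)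
      have p3 : a * b * (s * s) ≤ n ^ 2 * n ^ 2 * (d * n) / 4 := by
        have q1 := mul_le_mul_of_nonneg_left p1 hab0
        have q2 := mul_le_mul_of_nonneg_right p2 (by positivity : 0 ≤ d * n)
        nlinarith
      have : (a * b * e0) * (n ^ 2 * K) ≤ (n ^ 2 * K / 4) * (n ^ 2 * K) := by
        have q1 : (a * b * e0) * (n ^ 2 * K) = a * b * (s * s) := by rw [mul_assoc, hKe]; ring
        have q2 : (n ^ 2 * K / 4) * (n ^ 2 * K) = n ^ 2 * n ^ 2 * (2 * d * n) / 4 := by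
          rw [← hK2]; ring
        rw [q1, q2]
        have : 0 ≤ n ^ 2 * n ^ 2 * (d * n) := by positivity
        linarith
      have := le_of_mul_le_mul_right this (by positivity)
      linarith
  have k2 : a * b * e + M ≤ n ^ 2 * K / 4 := by
    nlinarith [mul_le_mul_of_nonneg_left hlt.le hab0]
  have k3 : e * (a * b * e + M) ≤ e * (n ^ 2 * K / 4) := mul_le_mul_of_nonneg_left k2 he
  have k4 : e * (n ^ 2 * K / 4) < e0 * (n ^ 2 * K / 4) :=
    mul_lt_mul_of_pos_right hlt (by positivity)
  nlinarith

/-- Let `G` be a finite simple graph with `n` vertices, average degree `d`,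
and degree deviation `s > 0`. If either `s > dn/√2`, or `s ≤ dn/√2` and `d ≤ n/2`, then
`λ(G) − d ≥ s²/(n²√(2dn))`. -/
theorem spectral_radius_minus_average_degree_lower_bound
    {V : Type*} [Fintype V] [DecidableEq V] (G : SimpleGraph V) [DecidableRel G.Adj]
    (n d s lam : ℝ)
    (hn : n = Fintype.card V)
    (hd : d = 2 * G.edgeFinset.card / n)
    (hs : s = ∑ u : V, |(G.degree u : ℝ) - d|)
    (hlam : IsLargestEigenvalue (G.adjMatrix ℝ) lam)
    (hspos : 0 < s)
    (hcase : s > d * n / Real.sqrt 2 ∨ (s ≤ d * n / Real.sqrt 2 ∧ d ≤ n / 2)) :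
    lam - d ≥ s ^ 2 / (n ^ 2 * Real.sqrt (2 * d * n)) := by
  classical
  have hV : Nonempty V := by
    by_contra hne
    rw [not_nonempty_iff] at hne
    simp at hs
    linarith
  have hnpos : 0 < n := by rw [hn]; exact_mod_cast Fintype.card_pos
  have hdeg : ∑ u : V, (G.degree u : ℝ) = n * d := by
    have := G.sum_degrees_eq_twice_card_edges
    rw [hd, mul_div_cancel₀ _ hnpos.ne']
    exact_mod_cast this
  have hdegn : ∀ u, (G.degree u : ℝ) ≤ n := fun u => by
    rw [hn]; exact_mod_cast (G.degree_lt_card_verts u).le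
  have hd0 : 0 ≤ d := by rw [hd]; positivity
  have hcard : ∑ u : V, (1 : ℝ) = n := by simp [hn]
  have hdpos : 0 < d := by
    rcases hd0.lt_or_eq with h | h
    · exact h
    · exfalso
      rw [← h] at hs hdeg
      simp only [sub_zero, Nat.abs_cast] at hs
      linarith
  have hdn : d ≤ n := by
    have : ∑ u : V, (G.degree u : ℝ) ≤ ∑ u : V, n := Finset.sum_le_sum fun u _ => hdegn u
    rw [hdeg, Finset.sum_const, Finset.card_univ, nsmul_eq_mul, ← hn] at this
    exact le_of_mul_le_mul_left this hnpos
  have hray := aux_rayleigh (G.adjMatrix ℝ) (by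
    ext u w
    simp [SimpleGraph.adjMatrix_apply, G.adj_comm]) lam hlam
  set A := G.adjMatrix ℝ with hA
  have hAsymm : ∀ u w, A u w = A w u := fun u w => by
    simp [hA, SimpleGraph.adjMatrix_apply, G.adj_comm]
  have hA0 : ∀ u w, 0 ≤ A u w := fun u w => by
    simp only [hA, SimpleGraph.adjMatrix_apply]; split_ifs <;> norm_num
  have hArow : ∀ u, ∑ w, A u w = G.degree u := fun u => by
    simp [hA, SimpleGraph.adjMatrix_apply, ← SimpleGraph.card_neighborFinset_eq_degree,
      SimpleGraph.neighborFinset_eq_filter]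
  let c : V → ℝ := fun u => if d < G.degree u then 1 else 0
  let c' : V → ℝ := fun u => if d < G.degree u then 0 else 1
  have hcc : ∀ u, c u + c' u = 1 := fun u => by simp only [c, c']; split_ifs <;> norm_num
  have hcc0 : ∀ u, c u * c' u = 0 := fun u => by simp only [c, c']; split_ifs <;> norm_num
  have hc2 : ∀ u, c u * c u = c u := fun u => by simp only [c]; split_ifs <;> norm_num
  have hc'2 : ∀ u, c' u * c' u = c' u := fun u => by simp only [c']; split_ifs <;> norm_num
  have hc0 : ∀ u, 0 ≤ c u := fun u => by simp only [c]; split_ifs <;> norm_num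
  have hc'0 : ∀ u, 0 ≤ c' u := fun u => by simp only [c']; split_ifs <;> norm_num
  obtain ⟨a, ha⟩ : ∃ a, a = ∑ u, c u := ⟨_, rfl⟩
  obtain ⟨b, hb⟩ : ∃ b, b = ∑ u, c' u := ⟨_, rfl⟩
  obtain ⟨X, hX⟩ : ∃ X, X = ∑ u, ∑ w, c u * A u w * c w := ⟨_, rfl⟩
  obtain ⟨y, hy⟩ : ∃ y, y = ∑ u, ∑ w, c u * A u w * c' w := ⟨_, rfl⟩
  obtain ⟨z, hz⟩ : ∃ z, z = ∑ u, ∑ w, c' u * A u w * c' w := ⟨_, rfl⟩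
  have hy' : y = ∑ u, ∑ w, c' u * A u w * c w := by
    rw [hy, Finset.sum_comm]
    refine Finset.sum_congr rfl fun u _ => Finset.sum_congr rfl fun w _ => ?_
    rw [hAsymm w u]; ring
  have ha0 : 0 ≤ a := by rw [ha]; exact Finset.sum_nonneg fun u _ => hc0 u
  have hb0 : 0 ≤ b := by rw [hb]; exact Finset.sum_nonneg fun u _ => hc'0 u
  have hX0 : 0 ≤ X := by
    rw [hX]; exact Finset.sum_nonneg fun u _ => Finset.sum_nonneg fun w _ =>
      mul_nonneg (mul_nonneg (hc0 u) (hA0 u w)) (hc0 w)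
  have hy0 : 0 ≤ y := by
    rw [hy]; exact Finset.sum_nonneg fun u _ => Finset.sum_nonneg fun w _ =>
      mul_nonneg (mul_nonneg (hc0 u) (hA0 u w)) (hc'0 w)
  have hz0 : 0 ≤ z := by
    rw [hz]; exact Finset.sum_nonneg fun u _ => Finset.sum_nonneg fun w _ =>
      mul_nonneg (mul_nonneg (hc'0 u) (hA0 u w)) (hc'0 w)
  have hab : a + b = n := by
    rw [ha, hb, ← Finset.sum_add_distrib, ← hcard]
    exact Finset.sum_congr rfl fun u _ => hcc u
  have hXy : X + y = ∑ u, c u * G.degree u := by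
    rw [hX, hy, ← Finset.sum_add_distrib]
    refine Finset.sum_congr rfl fun u _ => ?_
    rw [← Finset.sum_add_distrib, ← hArow, Finset.mul_sum]
    refine Finset.sum_congr rfl fun w _ => ?_
    rw [← mul_add, hcc, mul_one]
  have hyz : y + z = ∑ u, c' u * G.degree u := by
    rw [hy', hz, ← Finset.sum_add_distrib]
    refine Finset.sum_congr rfl fun u _ => ?_
    rw [← Finset.sum_add_distrib, ← hArow, Finset.mul_sum]
    refine Finset.sum_congr rfl fun w _ => ?_
    rw [← mul_add, hcc, mul_one]
  have htot : (X + y) + (y + z) = n * d := by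
    rw [hXy, hyz, ← Finset.sum_add_distrib, ← hdeg]
    refine Finset.sum_congr rfl fun u _ => ?_
    rw [← add_mul, hcc, one_mul]
  have hsdiff : s = ((X + y) - a * d) - ((y + z) - b * d) := by
    rw [hXy, hyz, ha, hb, Finset.sum_mul, Finset.sum_mul, ← Finset.sum_sub_distrib,
      ← Finset.sum_sub_distrib, ← Finset.sum_sub_distrib, hs]
    refine Finset.sum_congr rfl fun u _ => ?_
    simp only [c, c']
    split_ifs with h
    · rw [abs_of_pos (by linarith)]; ring
    · rw [abs_of_nonpos (by linarith)]; ring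
  have hX1 : X = a * d + s / 2 - y := by subst hab; linarith
  have hz1 : z = b * d - s / 2 - y := by subst hab; linarith
  have hXn : X + y ≤ a * n := by
    rw [hXy, ha, Finset.sum_mul]
    exact Finset.sum_le_sum fun u _ => mul_le_mul_of_nonneg_left (hdegn u) (hc0 u)
  have hQ : ∀ α β : ℝ, α ^ 2 * X + 2 * α * β * y + β ^ 2 * z
      ≤ lam * (α ^ 2 * a + β ^ 2 * b) := by
    intro α β
    have h := hray (fun u => α * c u + β * c' u)
    have e1 : (fun u => α * c u + β * c' u) ⬝ᵥ A.mulVec (fun u => α * c u + β * c' u)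
        = α ^ 2 * X + 2 * α * β * y + β ^ 2 * z := by
      have : α ^ 2 * X + 2 * α * β * y + β ^ 2 * z
        = α ^ 2 * X + α * β * y + α * β * y + β ^ 2 * z := by ring
      rw [this]
      nth_rewrite 2 [hy']
      rw [hX, hy, hz]
      simp only [dotProduct, Matrix.mulVec, Finset.mul_sum, ← Finset.sum_add_distrib]
      refine Finset.sum_congr rfl fun u _ => Finset.sum_congr rfl fun w _ => ?_
      ring
    have e2 : (fun u => α * c u + β * c' u) ⬝ᵥ (fun u => α * c u + β * c' u)
        = α ^ 2 * a + β ^ 2 * b := by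
      rw [ha, hb]
      simp only [dotProduct, Finset.mul_sum, ← Finset.sum_add_distrib]
      refine Finset.sum_congr rfl fun u _ => ?_
      linear_combination α ^ 2 * hc2 u + β ^ 2 * hc'2 u + 2 * α * β * hcc0 u
    rw [e1, e2] at h
    exact h
  have he : 0 ≤ lam - d := by
    have h := hQ 1 1
    have : n * d ≤ n * lam := by
      have : lam * (1 ^ 2 * a + 1 ^ 2 * b) = n * lam := by rw [← hab]; ring
      rw [this] at h
      linarith
    linarith [le_of_mul_le_mul_left this hnpos]
  obtain ⟨e, hedef⟩ : ∃ e, e = lam - d := ⟨_, rfl⟩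
  have hlame : lam = d + e := by linarith
  rw [← hedef] at he ⊢
  have hT : 0 < lam * b - z := by
    rw [hlame, hz1]
    nlinarith [mul_nonneg he hb0]
  have hdet : y ^ 2 ≤ (lam * a - X) * (lam * b - z) := by
    have h := hQ (lam * b - z) y
    have : (lam * b - z) * y ^ 2 ≤ (lam * b - z) * ((lam * a - X) * (lam * b - z)) := by
      linear_combination h
    exact le_of_mul_le_mul_left this hT
  refine aux_real n d s a b y e (Real.sqrt (2 * d * n)) hnpos hdpos hdn hspos ha0 hb0 hab he
    (by linarith) (by linarith) (by linarith) ?_ (Real.sqrt_pos.2 (by positivity))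
    (Real.sq_sqrt (by positivity)) ?_ ?_
  · nlinarith [mul_nonneg ha0 hd0]
  · rcases hcase with h | h
    · left
      have h2 : (0 : ℝ) < Real.sqrt 2 := by positivity
      rw [gt_iff_lt, div_lt_iff₀ h2] at h
      have h3 := mul_le_mul h.le h.le (by positivity) (by positivity)
      nlinarith [Real.sq_sqrt (by norm_num : (0 : ℝ) ≤ 2)]
    · exact Or.inr h.2
  · rw [hX1, hz1, hlame] at hdet
    subst hab
    linear_combination hdet
end

section
/- If G is a finite simple graph with n vertices, average degree d, and degree deviation s with s > 0 and d > n/2, then λ(G) ≥ d + s²/n³ − 2(d+n)s⁴/n⁸. -/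
theorem rayleigh_aux {V : Type*} [Fintype V] [DecidableEq V] (A : Matrix V V ℝ)
    (hA : A.IsHermitian) (l : ℝ) (h : IsLargestEigenvalue A l) (u : V → ℝ) :
    ∑ i, ∑ j, A i j * (u i * u j) ≤ l * ∑ i, u i ^ 2 := by
  have hB : (l • (1 : Matrix V V ℝ) - A).IsHermitian := by
    have h1 : (l • (1 : Matrix V V ℝ)).IsHermitian := by
      simp [Matrix.IsHermitian]
    exact h1.sub hA
  have hp : (l • (1 : Matrix V V ℝ) - A).PosSemidef := by
    rw [hB.posSemidef_iff_eigenvalues_nonneg]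
    intro i
    have h1 := hB.mulVec_eigenvectorBasis i
    have h2 : l - hB.eigenvalues i ≤ l := by
      apply h.2
      refine ⟨(hB.eigenvectorBasis i).ofLp, ?_, ?_⟩
      · intro h0
        have h3 := hB.eigenvectorBasis.orthonormal.ne_zero i
        apply h3
        ext j
        exact congrFun h0 j
      · rw [Matrix.sub_mulVec, Matrix.smul_mulVec, Matrix.one_mulVec] at h1
        rw [sub_smul, ← h1]
        simp
    simpa using h2
  have h3 := hp.dotProduct_mulVec_nonneg u
  have h4 : star u ⬝ᵥ ((l • (1 : Matrix V V ℝ) - A).mulVec u)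
      = l * ∑ i, u i ^ 2 - ∑ i, ∑ j, A i j * (u i * u j) := by
    rw [Matrix.sub_mulVec, Matrix.smul_mulVec, Matrix.one_mulVec, dotProduct_sub]
    congr 1
    · simp only [dotProduct, Finset.mul_sum]
      refine Finset.sum_congr rfl fun i _ => ?_
      simp; ring
    · simp only [dotProduct, Matrix.mulVec, Finset.mul_sum]
      refine Finset.sum_congr rfl fun i _ => Finset.sum_congr rfl fun j _ => ?_
      simp; ring
  rw [h4] at h3
  linarith

theorem quad_aux {V : Type*} [Fintype V] [DecidableEq V] (G : SimpleGraph V) [DecidableRel G.Adj]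
    (g : V → ℝ) :
    ∑ i, (G.degree i : ℝ) * (1 + 2 * g i) + (∑ i, g i) ^ 2
      - ∑ i, ((Fintype.card V : ℝ) - G.degree i) * g i ^ 2
    ≤ ∑ i, ∑ j, G.adjMatrix ℝ i j * ((1 + g i) * (1 + g j)) := by
  have hdeg : ∀ i, ∑ j, G.adjMatrix ℝ i j = G.degree i := by
    intro i
    have := G.adjMatrix_mulVec_const_apply (α := ℝ) (a := 1) (v := i)
    simpa [Matrix.mulVec, dotProduct] using this
  have hsymm : ∀ i j, G.adjMatrix ℝ i j = G.adjMatrix ℝ j i := by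
    intro i j
    simp [SimpleGraph.adjMatrix_apply, G.adj_comm]
  have h01 : ∀ i j, G.adjMatrix ℝ i j ≤ 1 := by
    intro i j
    rw [SimpleGraph.adjMatrix_apply]; split_ifs <;> norm_num
  -- the half-sum
  have hF : ∀ F : V → ℝ, ∑ i, ∑ j, G.adjMatrix ℝ i j * F i = ∑ i, (G.degree i : ℝ) * F i := by
    intro F
    refine Finset.sum_congr rfl fun i _ => ?_
    rw [← Finset.sum_mul, hdeg]
  have hF' : ∀ F : V → ℝ, ∑ i, ∑ j, G.adjMatrix ℝ i j * F j = ∑ i, (G.degree i : ℝ) * F i := by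
    intro F
    rw [Finset.sum_comm, ← hF]
    refine Finset.sum_congr rfl fun i _ => Finset.sum_congr rfl fun j _ => ?_
    rw [hsymm]
  let K : V → ℝ := fun i => 1 / 2 + g i + g i ^ 2 / 2
  have key : ∑ i, ∑ j, (G.adjMatrix ℝ i j * K i + G.adjMatrix ℝ i j * K j
        + g i * g j - g i ^ 2 / 2 - g j ^ 2 / 2)
      ≤ ∑ i, ∑ j, G.adjMatrix ℝ i j * ((1 + g i) * (1 + g j)) := by
    refine Finset.sum_le_sum fun i _ => Finset.sum_le_sum fun j _ => ?_
    simp only [K]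
    nlinarith [mul_nonneg (sub_nonneg.2 (h01 i j)) (sq_nonneg (g i - g j))]
  refine le_trans (le_of_eq ?_) key
  simp only [Finset.sum_add_distrib, Finset.sum_sub_distrib, hF, hF', Finset.sum_const,
    Finset.card_univ, nsmul_eq_mul]
  rw [← Finset.sum_mul_sum, ← Finset.mul_sum, ← Finset.sum_div]
  simp only [sub_mul, Finset.sum_sub_distrib, ← Finset.mul_sum]
  have hK : ∑ i, (G.degree i : ℝ) * K i + ∑ i, (G.degree i : ℝ) * K i
      = ∑ i, (G.degree i : ℝ) * (1 + 2 * g i) + ∑ i, (G.degree i : ℝ) * g i ^ 2 := by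
    rw [← Finset.sum_add_distrib, ← Finset.sum_add_distrib]
    refine Finset.sum_congr rfl fun i _ => ?_
    simp only [K]; ring
  rw [hK]; ring

set_option maxHeartbeats 2000000 in
/-- If `G` is a finite simple graph with `n` vertices, average degree `d`,
and degree deviation `s` with `s > 0` and `d > n/2`, then
`λ(G) ≥ d + s²/n³ − 2(d+n)s⁴/n⁸`. -/
theorem spectral_radius_lower_bound_large_average_degree
    {V : Type*} [Fintype V] [DecidableEq V] (G : SimpleGraph V) [DecidableRel G.Adj]
    (n d s lam : ℝ)
    (hn : n = Fintype.card V)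
    (hd : d = 2 * G.edgeFinset.card / n)
    (hs : s = ∑ u : V, |(G.degree u : ℝ) - d|)
    (hlam : IsLargestEigenvalue (G.adjMatrix ℝ) lam)
    (hspos : 0 < s)
    (hdn : d > n / 2) :
    lam ≥ d + s ^ 2 / n ^ 3 - 2 * (d + n) * s ^ 4 / n ^ 8 := by
  have hn0 : 0 < n := by
    rw [hn]
    rcases isEmpty_or_nonempty V with h | h
    · simp [hs] at hspos
    · exact_mod_cast Fintype.card_pos
  have hsumdeg : ∑ u, (G.degree u : ℝ) = d * n := by
    have := G.sum_degrees_eq_twice_card_edges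
    rw [hd, div_mul_cancel₀ _ hn0.ne']
    exact_mod_cast this
  have hcard : ∑ _u : V, (1 : ℝ) = n := by simp [hn]
  obtain ⟨f, hf⟩ : ∃ f : V → ℝ, ∀ i, (G.degree i : ℝ) = d + n * f i :=
    ⟨fun i => ((G.degree i : ℝ) - d) / n, fun i => by field_simp; ring⟩
  have hfhalf : ∀ i, f i < 1 / 2 := by
    intro i
    have h1 : (G.degree i : ℝ) < n := by
      rw [hn]; exact_mod_cast G.degree_lt_card_verts i
    rw [hf i] at h1
    by_contra h2
    push Not at h2
    nlinarith
  have hf0 : ∑ i, f i = 0 := by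
    have h1 : ∑ i, (d * 1 + n * f i) = d * n := by rw [← hsumdeg]; simp [hf]
    rw [Finset.sum_add_distrib, ← Finset.mul_sum, ← Finset.mul_sum, hcard] at h1
    have : n * ∑ i, f i = 0 := by linarith
    exact (mul_eq_zero.1 this).resolve_left hn0.ne'
  have hfabs : n * ∑ i, |f i| = s := by
    rw [hs, Finset.mul_sum]
    refine Finset.sum_congr rfl fun i _ => ?_
    rw [hf i, add_sub_cancel_left, abs_mul, abs_of_pos hn0]
  obtain ⟨g, hg⟩ : ∃ g : V → ℝ, ∀ i, (1 + g i) * (1 - f i) = 1 := by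
    refine ⟨fun i => 1 / (1 - f i) - 1, fun i => ?_⟩
    have : 1 - f i ≠ 0 := by linarith [hfhalf i]
    field_simp; ring
  have hgpos : ∀ i, 0 < 1 + g i := by
    intro i
    have := hfhalf i
    by_contra h
    nlinarith [hg i]
  have hg2 : ∀ i, 1 + g i ≤ 2 := by
    intro i
    nlinarith [hg i, hfhalf i, hgpos i]
  have hray := rayleigh_aux (G.adjMatrix ℝ) (G.isSymm_adjMatrix (α := ℝ)) lam hlam (fun i => 1 + g i)
  have hquad := quad_aux G g
  rw [← hn] at hquad
  set S := ∑ i, g i with hS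
  have hQ : ∑ i, g i ^ 2 ≤ 2 * S := by
    have : ∑ i, g i ^ 2 ≤ ∑ i, (2 * g i - 2 * f i) := by
      refine Finset.sum_le_sum fun i _ => ?_
      have e1 : g i = f i * (1 + g i) := by linarith [hg i]
      have e2 : 2 * g i - 2 * f i = 2 * (f i ^ 2 * (1 + g i)) := by
        linear_combination 2 * e1 + 2 * f i * e1
      have e3 : g i ^ 2 = f i ^ 2 * (1 + g i) * (1 + g i) := by
        linear_combination (g i + f i * (1 + g i)) * e1
      rw [e2, e3]
      nlinarith [mul_nonneg (sq_nonneg (f i)) (hgpos i).le, hg2 i]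
    rw [Finset.sum_sub_distrib, ← Finset.mul_sum, ← Finset.mul_sum, hf0] at this
    linarith
  have hU : ∑ i, (1 + g i) ^ 2 = n + 2 * S + ∑ i, g i ^ 2 := by
    rw [hS, ← hcard, Finset.mul_sum, ← Finset.sum_add_distrib, ← Finset.sum_add_distrib]
    exact Finset.sum_congr rfl fun i _ => by ring
  have hmain : ∑ i, (G.degree i : ℝ) * (1 + 2 * g i) - ∑ i, (n - G.degree i) * g i ^ 2
      = d * ∑ i, (1 + g i) ^ 2 + n * S := by
    rw [hS, Finset.mul_sum, Finset.mul_sum, ← Finset.sum_sub_distrib, ← Finset.sum_add_distrib]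
    refine Finset.sum_congr rfl fun i _ => ?_
    rw [hf i]
    linear_combination (-n * (1 + g i)) * hg i
  set σ := s / n ^ 2 with hσ
  have hσs : ∑ i, |f i| = σ * n := by
    rw [hσ, ← hfabs]; field_simp
  have hSσ : n * σ ^ 2 ≤ S := by
    have h1 : ∑ i, (-σ ^ 2 * 1 + (1 + σ ^ 2) * f i + 2 * σ * |f i|) ≤ ∑ i, g i := by
      refine Finset.sum_le_sum fun i _ => ?_
      have key : ∀ a : ℝ, 2 * a - a ^ 2 * (1 - f i) ≤ 1 + g i := by
        intro a
        have : (1 + g i) - (2 * a - a ^ 2 * (1 - f i))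
            = (1 - f i) * (a - (1 + g i)) ^ 2 := by
          linear_combination (2 * a - (1 + g i)) * hg i
        have h2 : 0 ≤ (1 - f i) * (a - (1 + g i)) ^ 2 :=
          mul_nonneg (by linarith [hfhalf i]) (sq_nonneg _)
        linarith
      rcases abs_cases (f i) with ⟨h, _⟩ | ⟨h, _⟩
      · rw [h]; linarith [key (1 + σ)]
      · rw [h]; linarith [key (1 - σ)]
    rw [Finset.sum_add_distrib, Finset.sum_add_distrib, ← Finset.mul_sum, ← Finset.mul_sum,
      ← Finset.mul_sum, hcard, hf0, hσs] at h1
    linarith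
  have hS0 : 0 ≤ S := le_trans (by positivity) hSσ
  have hfin : n * S + S ^ 2 ≤ (lam - d) * (n + 2 * S + ∑ i, g i ^ 2) := by
    rw [← hU]; linarith
  have hQ0 : 0 ≤ ∑ i, g i ^ 2 := Finset.sum_nonneg fun i _ => sq_nonneg _
  have hld : 0 ≤ lam - d := by
    by_contra h
    push Not at h
    have : (lam - d) * (n + 2 * S + ∑ i, g i ^ 2) < 0 :=
      mul_neg_of_neg_of_pos h (by linarith)
    nlinarith
  have hfin2 : n * S + S ^ 2 ≤ (lam - d) * (n + 4 * S) :=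
    hfin.trans (mul_le_mul_of_nonneg_left (by linarith) hld)
  obtain ⟨H, hH⟩ : ∃ H, S = n * H := ⟨S / n, by field_simp⟩
  obtain ⟨l, hl⟩ : ∃ l, lam - d = n * l := ⟨(lam - d) / n, by field_simp⟩
  obtain ⟨z, hz⟩ : ∃ z, z = σ ^ 2 := ⟨_, rfl⟩
  have hz0 : 0 ≤ z := by rw [hz]; positivity
  have hHz : z ≤ H := by
    rw [hH, ← hz] at hSσ
    exact le_of_mul_le_mul_left hSσ hn0
  have hlH : H + H ^ 2 ≤ l * (1 + 4 * H) := by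
    rw [hH, hl] at hfin2
    refine le_of_mul_le_mul_left ?_ (pow_pos hn0 2)
    linarith
  have hl3 : z - 3 * z ^ 2 ≤ l := by
    have h4 : (z - 3 * z ^ 2) * (1 + 4 * H) ≤ l * (1 + 4 * H) := by
      refine le_trans ?_ hlH
      have h5 : 0 ≤ 1 + H + z - 4 * (z - 3 * z ^ 2) := by
        nlinarith [sq_nonneg (6 * z - 1)]
      have h6 : 0 ≤ z ^ 3 := by positivity
      nlinarith [mul_nonneg (sub_nonneg.2 hHz) h5]
    exact le_of_mul_le_mul_right h4 (by linarith)
  have e1 : s ^ 2 / n ^ 3 = n * z := by rw [hz, hσ]; field_simp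
  have e2 : 2 * (d + n) * s ^ 4 / n ^ 8 = 2 * (d + n) * z ^ 2 := by rw [hz, hσ]; field_simp
  rw [e1, e2]
  have h7 := mul_le_mul_of_nonneg_left hl3 hn0.le
  nlinarith [mul_nonneg (sub_nonneg.2 hdn.le) (sq_nonneg z)]
end

section
/- Let G be a finite simple graph with n vertices, m edges, and average degree d = 2m/n. Let V₊ = {u ∈ V(G) : d_G(u) > d}, V₋ = {u ∈ V(G) : d_G(u) ≤ d}, n₊ = |V₊|, n₋ = |V₋|, and assume n₊ ≥ 2 and n₋ ≥ 2. Let m₊ = m(G[V₊]), m₋ = m(G[V₋]), m_± = m − m₊ − m₋, and set w₊ = m₊/(n₊(n₊−1)/2), w₋ = m₋/(n₋(n₋−1)/2), w_± = m_±/(n₊n₋). Then λ(G) ≥ (1/2)( (n₊−1)w₊ + (n₋−1)w₋ + √( ((n₊−1)w₊ − (n₋−1)w₋)² + 4n₊n₋w_±² ) ). -/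
open Matrix in
theorem rayleigh_aux_s8 {V : Type*} [Fintype V] [DecidableEq V] (A : Matrix V V ℝ)
    (hA : A.IsHermitian) (lam : ℝ) (hlam : IsLargestEigenvalue A lam) (x : V → ℝ) :
    x ⬝ᵥ A.mulVec x ≤ lam * (x ⬝ᵥ x) := by
  have hB : (lam • (1 : Matrix V V ℝ) - A).IsHermitian := by
    apply Matrix.IsHermitian.sub _ hA
    ext i j
    simp [Matrix.one_apply, eq_comm]
  have hps : (lam • (1 : Matrix V V ℝ) - A).PosSemidef := by
    rw [hB.posSemidef_iff_eigenvalues_nonneg]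
    intro i
    have h1 := hB.mulVec_eigenvectorBasis i
    have h2 : (hB.eigenvectorBasis i).ofLp ≠ 0 := by
      intro h
      have := hB.eigenvectorBasis.orthonormal.ne_zero i
      apply this
      ext j
      exact congrFun h j
    have h3 := hlam.2 (lam - hB.eigenvalues i) ⟨_, h2, by
      rw [Matrix.sub_mulVec, Matrix.smul_mulVec, Matrix.one_mulVec] at h1
      rw [sub_smul, ← h1]
      abel⟩
    simp only [Pi.zero_apply]
    linarith
  have := hps.dotProduct_mulVec_nonneg x
  rw [Matrix.sub_mulVec, Matrix.smul_mulVec, Matrix.one_mulVec, dotProduct_sub,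
    dotProduct_smul] at this
  simp only [star_trivial, smul_eq_mul] at this
  linarith

theorem count_aux {V : Type*} [Fintype V] [DecidableEq V] (G : SimpleGraph V)
    [DecidableRel G.Adj] (S : Finset V) :
    ∑ u ∈ S, ∑ v ∈ S, G.adjMatrix ℝ u v
      = 2 * ((G.edgeFinset.filter (fun e => e ∈ S.sym2)).card : ℝ) := by
  classical
  let H : SimpleGraph V :=
    { Adj := fun u v => G.Adj u v ∧ u ∈ S ∧ v ∈ S
      symm := ⟨fun u v h => ⟨h.1.symm, h.2.2, h.2.1⟩⟩
      loopless := ⟨fun u h => G.loopless.irrefl u h.1⟩ }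
  have hE : H.edgeFinset = G.edgeFinset.filter (fun e => e ∈ S.sym2) := by
    ext e
    induction e with
    | _ u v => simp [H]
  have h := H.sum_degrees_eq_twice_card_edges
  rw [hE] at h
  have h' : (∑ v, (H.degree v : ℝ)) =
      2 * ((G.edgeFinset.filter (fun e => e ∈ S.sym2)).card : ℝ) := by exact_mod_cast h
  rw [← h', ← Finset.sum_subset (Finset.subset_univ S)]
  · refine Finset.sum_congr rfl fun u hu => ?_
    rw [← SimpleGraph.card_neighborFinset_eq_degree, SimpleGraph.neighborFinset_eq_filter]
    simp only [SimpleGraph.adjMatrix_apply, Finset.sum_boole]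
    congr 2
    ext v
    simp [H, hu, and_comm]
  · intro u _ hu
    rw [← SimpleGraph.card_neighborFinset_eq_degree, SimpleGraph.neighborFinset_eq_filter]
    simp [H, hu]

/-- With `V₊`, `V₋`, `n₊ = |V₊| ≥ 2`, `n₋ = |V₋| ≥ 2`,
`m₊ = m(G[V₊])`, `m₋ = m(G[V₋])`, `m_± = m − m₊ − m₋`, and
`w₊ = m₊/(n₊(n₊−1)/2)`, `w₋ = m₋/(n₋(n₋−1)/2)`, `w_± = m_±/(n₊n₋)`, the spectral radius
satisfies `λ(G) ≥ ½((n₊−1)w₊ + (n₋−1)w₋ + √(((n₊−1)w₊ − (n₋−1)w₋)² + 4n₊n₋w_±²))`. -/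
theorem spectral_radius_ge_smoothed_eigenvalue
    {V : Type*} [Fintype V] [DecidableEq V] (G : SimpleGraph V) [DecidableRel G.Adj]
    (n d lam : ℝ)
    (hn : n = Fintype.card V)
    (hd : d = 2 * G.edgeFinset.card / n)
    (hlam : IsLargestEigenvalue (G.adjMatrix ℝ) lam)
    (Vp Vm : Finset V)
    (hVp : Vp = Finset.univ.filter (fun u => d < (G.degree u : ℝ)))
    (hVm : Vm = Finset.univ.filter (fun u => (G.degree u : ℝ) ≤ d))
    (np nm : ℝ)
    (hnp : np = Vp.card) (hnm : nm = Vm.card)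
    (hnp2 : 2 ≤ np) (hnm2 : 2 ≤ nm)
    (mp mm mpm : ℝ)
    (hmp : mp = (G.edgeFinset.filter (fun e => e ∈ Vp.sym2)).card)
    (hmm : mm = (G.edgeFinset.filter (fun e => e ∈ Vm.sym2)).card)
    (hmpm : mpm = (G.edgeFinset.card : ℝ) - mp - mm)
    (wp wm wpm : ℝ)
    (hwp : wp = mp / (np * (np - 1) / 2))
    (hwm : wm = mm / (nm * (nm - 1) / 2))
    (hwpm : wpm = mpm / (np * nm)) :
    lam ≥ (1 / 2) * ((np - 1) * wp + (nm - 1) * wm +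
      Real.sqrt (((np - 1) * wp - (nm - 1) * wm) ^ 2 + 4 * np * nm * wpm ^ 2)) := by
  have hdisj : Disjoint Vp Vm := by
    rw [hVp, hVm, Finset.disjoint_left]
    intro u h1 h2
    simp only [Finset.mem_filter] at h1 h2
    linarith [h1.2, h2.2]
  have hun : Vp ∪ Vm = Finset.univ := by
    ext u
    simp only [hVp, hVm, Finset.mem_union, Finset.mem_filter, Finset.mem_univ, true_and, iff_true]
    exact lt_or_ge _ _
  have hsum : ∀ f : V → ℝ, ∑ u, f u = ∑ u ∈ Vp, f u + ∑ u ∈ Vm, f u := by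
    intro f
    rw [← hun, Finset.sum_union hdisj]
  have e1 := count_aux G Vp
  have e2 := count_aux G Vm
  have e3 := count_aux G Finset.univ
  rw [← hmp] at e1
  rw [← hmm] at e2
  have hf : G.edgeFinset.filter (fun e => e ∈ (Finset.univ : Finset V).sym2) = G.edgeFinset := by
    ext e; simp
  rw [hf] at e3
  have hsw : ∑ u ∈ Vm, ∑ v ∈ Vp, G.adjMatrix ℝ u v = ∑ u ∈ Vp, ∑ v ∈ Vm, G.adjMatrix ℝ u v := by
    refine Finset.sum_comm.trans ?_
    refine Finset.sum_congr rfl fun u _ => Finset.sum_congr rfl fun v _ => ?_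
    simp [SimpleGraph.adjMatrix_apply, G.adj_comm]
  have e4 : ∑ u ∈ Vp, ∑ v ∈ Vm, G.adjMatrix ℝ u v = mpm := by
    simp only [hsum, Finset.sum_add_distrib] at e3
    linarith
  have key : ∀ s t : ℝ, 2 * mp * s ^ 2 + 2 * mpm * s * t + 2 * mm * t ^ 2
      ≤ lam * (np * s ^ 2 + nm * t ^ 2) := by
    intro s t
    have hr := rayleigh_aux_s8 (G.adjMatrix ℝ) (by
      ext i j; simp [SimpleGraph.adjMatrix_apply, G.adj_comm]) lam hlam
      (fun u => if u ∈ Vp then s else t)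
    have hp : ∀ f : V → ℝ → ℝ, ∑ u ∈ Vp, f u (if u ∈ Vp then s else t) = ∑ u ∈ Vp, f u s :=
      fun f => Finset.sum_congr rfl fun u hu => by rw [if_pos hu]
    have hm : ∀ f : V → ℝ → ℝ, ∑ u ∈ Vm, f u (if u ∈ Vp then s else t) = ∑ u ∈ Vm, f u t :=
      fun f => Finset.sum_congr rfl fun u hu => by
        rw [if_neg (Finset.disjoint_right.mp hdisj hu)]
    have q2 : (fun u => if u ∈ Vp then s else t) ⬝ᵥ (fun u => if u ∈ Vp then s else t)
        = np * s ^ 2 + nm * t ^ 2 := by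
      rw [dotProduct, hsum, hp (fun _ a => a * a), hm (fun _ a => a * a), hnp, hnm]
      simp only [Finset.sum_const, nsmul_eq_mul]
      ring
    have q1 : (fun u => if u ∈ Vp then s else t) ⬝ᵥ
        (G.adjMatrix ℝ).mulVec (fun u => if u ∈ Vp then s else t)
        = 2 * mp * s ^ 2 + 2 * mpm * s * t + 2 * mm * t ^ 2 := by
      have hi : ∀ u, (G.adjMatrix ℝ).mulVec (fun u => if u ∈ Vp then s else t) u
          = (∑ v ∈ Vp, G.adjMatrix ℝ u v) * s + (∑ v ∈ Vm, G.adjMatrix ℝ u v) * t := by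
        intro u
        rw [Matrix.mulVec, dotProduct, hsum, hp (fun v a => G.adjMatrix ℝ u v * a),
          hm (fun v a => G.adjMatrix ℝ u v * a), Finset.sum_mul, Finset.sum_mul]
      rw [dotProduct]
      simp only [hi]
      rw [hsum, hp (fun u a => a * ((∑ v ∈ Vp, G.adjMatrix ℝ u v) * s +
          (∑ v ∈ Vm, G.adjMatrix ℝ u v) * t)),
        hm (fun u a => a * ((∑ v ∈ Vp, G.adjMatrix ℝ u v) * s +
          (∑ v ∈ Vm, G.adjMatrix ℝ u v) * t)), ← Finset.mul_sum, ← Finset.mul_sum,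
        Finset.sum_add_distrib, Finset.sum_add_distrib, ← Finset.sum_mul, ← Finset.sum_mul,
        ← Finset.sum_mul, ← Finset.sum_mul, hsw, e1, e2, e4]
      ring
    rw [q1, q2] at hr
    exact hr
  clear hmp hmm
  have hnp0 : 0 < np := by linarith
  have hnm0 : 0 < nm := by linarith
  have hnp1 : np - 1 ≠ 0 := by linarith
  have hnm1 : nm - 1 ≠ 0 := by linarith
  have ha : (np - 1) * wp = 2 * mp / np := by rw [hwp]; field_simp
  have hb : (nm - 1) * wm = 2 * mm / nm := by rw [hwm]; field_simp
  have hc : 4 * np * nm * wpm ^ 2 = 4 * (mpm ^ 2 / (np * nm)) := by rw [hwpm]; field_simp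
  rw [ha, hb, hc]
  have hP : 0 ≤ lam * np - 2 * mp := by linarith [key 1 0]
  have hQ : 0 ≤ lam * nm - 2 * mm := by linarith [key 0 1]
  have hPQ : mpm ^ 2 ≤ (lam * np - 2 * mp) * (lam * nm - 2 * mm) := by
    have := discrim_le_zero (a := lam * np - 2 * mp) (b := -2 * mpm) (c := lam * nm - 2 * mm)
      (fun x => by linarith [key x 1])
    rw [discrim] at this
    linarith
  have hA : 2 * mp / np ≤ lam := by rw [div_le_iff₀ hnp0]; linarith
  have hB : 2 * mm / nm ≤ lam := by rw [div_le_iff₀ hnm0]; linarith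
  have hAB : mpm ^ 2 / (np * nm) ≤ (lam - 2 * mp / np) * (lam - 2 * mm / nm) := by
    rw [div_le_iff₀ (by positivity)]
    refine hPQ.trans (le_of_eq ?_)
    field_simp
  have hs : Real.sqrt ((2 * mp / np - 2 * mm / nm) ^ 2 + 4 * (mpm ^ 2 / (np * nm)))
      ≤ 2 * lam - 2 * mp / np - 2 * mm / nm := by
    apply Real.sqrt_le_iff.mpr
    constructor
    · linarith
    · nlinarith
  linarith
end
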